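/- Let α, β, η, γ be real numbers with (α,β) ≠ (0,0), let ρ₁ > 0, ρ₂ ≥ 0, let r* be the unique nonnegative solution of the CF fixed-point equation, and set R_cf = R_w(α,β,ρ₁(1−2^{−r*})). Then 0 ≤ R_cf ≤ min{R_w(α,β,ρ₁), R_w(η,γ,ρ₂)}; that is, the CF per-cell rate never exceeds either of the two cut values. -/

import Mathlib

/-- The Wyner per-cell sum-rate `R_w(a,b,ρ) = ∫₀¹ log₂(1 + ρ·(b + 2a·cos(2πf))²) df`. -/
noncomputable def Rw (a b ρ : ℝ) : ℝ :=
  ∫ f in (0:ℝ)..1, Real.logb 2 (1 + ρ * (b + 2 * a * Real.cos (2 * Real.pi * f)) ^ 2)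

theorem continuous_logb_one_add_mul_sq (a b : ℝ) {ρ : ℝ} (hρ : 0 ≤ ρ) :
    Continuous fun f : ℝ =>
      Real.logb 2 (1 + ρ * (b + 2 * a * Real.cos (2 * Real.pi * f)) ^ 2) := by
  refine Continuous.div_const (Continuous.log (by fun_prop) fun f => ?_) _
  positivity

theorem Rw_nonneg (a b : ℝ) {ρ : ℝ} (hρ : 0 ≤ ρ) : 0 ≤ Rw a b ρ := by
  refine intervalIntegral.integral_nonneg zero_le_one fun f _ => ?_
  refine Real.logb_nonneg one_lt_two (le_add_of_nonneg_right ?_)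
  positivity

theorem Rw_le_Rw (a b : ℝ) {ρ ρ' : ℝ} (hρ : 0 ≤ ρ) (h : ρ ≤ ρ') : Rw a b ρ ≤ Rw a b ρ' := by
  refine intervalIntegral.integral_mono_on zero_le_one
    ((continuous_logb_one_add_mul_sq a b hρ).intervalIntegrable _ _)
    ((continuous_logb_one_add_mul_sq a b (hρ.trans h)).intervalIntegrable _ _) fun f _ => ?_
  refine Real.logb_le_logb_of_le one_lt_two (by positivity) ?_
  gcongr

/-- If `r* ≥ 0` solves the CF fixed-point equation and `R_cf = R_w(α,β,ρ₁(1−2^{−r*}))`,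
then `0 ≤ R_cf ≤ min{R_w(α,β,ρ₁), R_w(η,γ,ρ₂)}`. -/
theorem stmt_5 (α β η γ ρ₁ ρ₂ rstar Rcf : ℝ) (hαβ : (α, β) ≠ (0, 0))
    (hρ₁ : 0 < ρ₁) (hρ₂ : 0 ≤ ρ₂) (hr : 0 ≤ rstar)
    (hfp : Rw α β (ρ₁ * (1 - (2:ℝ) ^ (-rstar))) = Rw η γ ρ₂ - rstar)
    (hRcf : Rcf = Rw α β (ρ₁ * (1 - (2:ℝ) ^ (-rstar)))) :
    0 ≤ Rcf ∧ Rcf ≤ min (Rw α β ρ₁) (Rw η γ ρ₂) := by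
  have hpos : (0:ℝ) < 2 ^ (-rstar) := by positivity
  have hle : (2:ℝ) ^ (-rstar) ≤ 1 :=
    Real.rpow_le_one_of_one_le_of_nonpos one_le_two (neg_nonpos.mpr hr)
  have h0 : 0 ≤ ρ₁ * (1 - (2:ℝ) ^ (-rstar)) := mul_nonneg hρ₁.le (sub_nonneg.mpr hle)
  have h1 : ρ₁ * (1 - (2:ℝ) ^ (-rstar)) ≤ ρ₁ :=
    mul_le_of_le_one_right hρ₁.le (sub_le_self 1 hpos.le)
  rw [hRcf]
  exact ⟨Rw_nonneg α β h0, le_min (Rw_le_Rw α β h0 h1) (hfp.trans_le (sub_le_self _ hr))⟩
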